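/- (Correctness of message passing for left min-marginals on a chain.) Let n ≥ 1, let L be a finite nonempty set, let f_i : L → ℝ for i = 1,…,n and f_{i,i+1} : L × L → ℝ for i = 1,…,n−1. Define left messages recursively by φ_1(s) = 0 and φ_{i+1}(s) = min over t ∈ L of (φ_i(t) + f_i(t) + f_{i,i+1}(t, s)) for 1 ≤ i ≤ n−1. Then for every 2 ≤ i ≤ n and every s ∈ L, φ_i(s) equals the minimum over all partial assignments (x_1, …, x_{i−1}) ∈ L^{i−1} of ∑_{i'=1}^{i−1} f_{i'}(x_{i'}) + ∑_{i'=1}^{i−2} f_{i',i'+1}(x_{i'}, x_{i'+1}) + f_{i−1,i}(x_{i−1}, s). -/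

import Mathlib

/-- The cost of a partial assignment `x` to the nodes `1, …, k + 1` whose right neighbour has
label `s`. -/
def leftCost {L : Type*} (f : ℕ → L → ℝ) (p : ℕ → L → L → ℝ) (k : ℕ) (x : Fin (k + 1) → L)
    (s : L) : ℝ :=
  (∑ j : Fin (k + 1), f (j.val + 1) (x j)) +
    (∑ j : Fin k, p (j.val + 1) (x j.castSucc) (x j.succ)) + p (k + 1) (x (Fin.last k)) s

theorem leftCost_zero {L : Type*} (f : ℕ → L → ℝ) (p : ℕ → L → L → ℝ) (x : Fin 1 → L) (s : L) :
    leftCost f p 0 x s = f 1 (x 0) + p 1 (x 0) s := by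
  simp [leftCost]

theorem leftCost_snoc {L : Type*} (f : ℕ → L → ℝ) (p : ℕ → L → L → ℝ) (k : ℕ)
    (x : Fin (k + 1) → L) (t s : L) :
    leftCost f p (k + 1) (Fin.snoc x t : Fin (k + 2) → L) s =
      leftCost f p k x t + f (k + 2) t + p (k + 2) t s := by
  have hp := Fin.sum_univ_castSucc fun j : Fin (k + 1) =>
    p (j.val + 1) ((Fin.snoc x t : Fin (k + 2) → L) j.castSucc)
      ((Fin.snoc x t : Fin (k + 2) → L) j.succ)
  simp only [Fin.succ_castSucc, Fin.succ_last, Fin.snoc_castSucc, Fin.snoc_last,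
    Fin.val_castSucc, Fin.val_last] at hp
  simp only [leftCost, Fin.sum_univ_castSucc (n := k + 1), Fin.snoc_castSucc, Fin.snoc_last,
    Fin.val_castSucc, Fin.val_last]
  rw [hp]
  ring

/-- A left message is the least cost of a partial assignment to the nodes before it. -/
theorem isLeast_range_leftCost {L : Type*} [Fintype L] [Nonempty L] {n : ℕ}
    {f : ℕ → L → ℝ} {p : ℕ → L → L → ℝ} {phi : ℕ → L → ℝ}
    (hphi1 : ∀ s : L, phi 1 s = 0)
    (hrec : ∀ i : ℕ, 1 ≤ i → i ≤ n - 1 → ∀ s : L,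
      phi (i + 1) s =
        Finset.univ.inf' Finset.univ_nonempty (fun t : L => phi i t + f i t + p i t s))
    (k : ℕ) (hk : k + 2 ≤ n) (s : L) :
    IsLeast (Set.range fun x => leftCost f p k x s) (phi (k + 2) s) := by
  induction k generalizing s with
  | zero =>
    rw [hrec 1 le_rfl (by omega)]
    constructor
    · obtain ⟨t, -, ht⟩ := Finset.exists_mem_eq_inf' Finset.univ_nonempty
        (fun t : L => phi 1 t + f 1 t + p 1 t s)
      exact ⟨fun _ => t, by rw [ht]; simp [leftCost_zero, hphi1]⟩
    · rintro _ ⟨x, rfl⟩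
      refine (Finset.inf'_le _ (Finset.mem_univ (x 0))).trans_eq ?_
      simp [leftCost_zero, hphi1]
  | succ k ih =>
    rw [hrec (k + 2) (by omega) (by omega)]
    constructor
    · obtain ⟨t, -, ht⟩ := Finset.exists_mem_eq_inf' Finset.univ_nonempty
        (fun t : L => phi (k + 2) t + f (k + 2) t + p (k + 2) t s)
      obtain ⟨x, hx⟩ := (ih (by omega) t).1
      exact ⟨Fin.snoc x t, by rw [ht, ← hx]; exact leftCost_snoc f p k x t s⟩
    · rintro _ ⟨x, rfl⟩
      obtain ⟨y, t, rfl⟩ : ∃ (y : Fin (k + 1) → L) (t : L), x = Fin.snoc y t :=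
        ⟨Fin.init x, x (Fin.last _), (Fin.snoc_init_self x).symm⟩
      refine (Finset.inf'_le _ (Finset.mem_univ t)).trans ?_
      simp only [leftCost_snoc]
      gcongr
      exact (ih (by omega) t).2 ⟨y, rfl⟩

/-- Correctness of message passing for left min-marginals on a chain.
Nodes are `1, …, n`; `f i` is the unary cost at node `i` (for `1 ≤ i ≤ n`) and `p i` is the
pairwise cost of edge `(i, i+1)` (for `1 ≤ i ≤ n−1`).  The left messages `φ` satisfy
`φ 1 = 0` and the recursion `φ (i+1) s = min_t (φ i t + f i t + p i t s)`.
Then for `2 ≤ i ≤ n`, `φ i s` is the minimum over partial assignments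
`(x_1, …, x_{i−1}) ∈ L^{i−1}` (encoded as `x : Fin (i−1) → L`, with `x j = x_{j+1}`) of
`∑_{i'=1}^{i−1} f i' (x_{i'}) + ∑_{i'=1}^{i−2} p i' (x_{i'}) (x_{i'+1}) + p (i−1) (x_{i−1}) s`. -/
theorem left_messages_are_min_marginals {L : Type*} [Fintype L] [Nonempty L]
    (n : ℕ) (hn : 1 ≤ n)
    (f : ℕ → L → ℝ) (p : ℕ → L → L → ℝ) (phi : ℕ → L → ℝ)
    (hphi1 : ∀ s : L, phi 1 s = 0)
    (hrec : ∀ i : ℕ, 1 ≤ i → i ≤ n - 1 → ∀ s : L,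
      phi (i + 1) s =
        Finset.univ.inf' Finset.univ_nonempty (fun t : L => phi i t + f i t + p i t s)) :
    ∀ (i : ℕ) (h2 : 2 ≤ i) (hi : i ≤ n) (s : L),
      phi i s =
        Finset.univ.inf' Finset.univ_nonempty (fun x : Fin (i - 1) → L =>
          (∑ j : Fin (i - 1), f (j.val + 1) (x j)) +
          (∑ j : Fin (i - 2), p (j.val + 1) (x ⟨j.val, by omega⟩) (x ⟨j.val + 1, by omega⟩)) +
          p (i - 1) (x ⟨i - 2, by omega⟩) s) := by
  intro i h2 hi s
  obtain ⟨k, rfl⟩ := Nat.exists_eq_add_of_le' h2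
  have h := isLeast_range_leftCost hphi1 hrec k hi s
  apply le_antisymm
  · exact Finset.le_inf' _ _ fun x _ => h.2 ⟨x, rfl⟩
  · obtain ⟨x, hx⟩ := h.1
    exact (Finset.inf'_le _ (Finset.mem_univ x)).trans_eq hx
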